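/- Closeness to the vanishing-TT solution for large d (Proposition 3.25): Suppose |t| ≠ 1. Then there exist c > 0 and D > 0 such that for all d ≥ D, if ψ is a solution of the model Lichnerowicz equation L_d with parameters (t, γ, η, μ) and ψ̂ is a solution of L_d with parameters (t, γ, 0, 0), then |ψ(x) − ψ̂(x)| ≤ c d^{−q} for all x ∈ ℝ. In particular ψ(0) and ψ̂(0) have the same limit as d → ∞. -/

import Mathlib

open Real Filter

/-- The 2π-periodic function equal to −1 on (−π,0) and 1 on (0,π). -/
noncomputable def lam (x : ℝ) : ℝ := if 0 < Real.sin x then 1 else -1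

/-- The critical exponent q = 2n/(n−2). -/
noncomputable def qex (n : ℕ) : ℝ := 2 * n / ((n : ℝ) - 2)

/-- The coupling constant κ = (n−1)/n. -/
noncomputable def kap (n : ℕ) : ℝ := ((n : ℝ) - 1) / n

/-- A solution of the model Lichnerowicz equation `L_d` with parameters t, γ, η, μ:
a 2π-periodic, positive, C¹ function, twice differentiable off the multiples of π,
satisfying the equation there. -/
def IsModelSolution (n : ℕ) (t γ η μ d : ℝ) (ψ : ℝ → ℝ) : Prop :=
  (∀ x, ψ (x + 2 * Real.pi) = ψ x) ∧
  (∀ x, 0 < ψ x) ∧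
  ContDiff ℝ 1 ψ ∧
  ∀ x : ℝ, (∀ k : ℤ, x ≠ (k : ℝ) * Real.pi) →
    DifferentiableAt ℝ (deriv ψ) x ∧
    -2 * kap n * qex n * d ^ (-(qex n - 2)) * deriv (deriv ψ) x
      - 2 * η ^ 2 * d ^ (-(2 * qex n)) * ψ x ^ (-qex n - 1)
      - kap n * (μ * d ^ (-qex n) + γ + lam x) ^ 2 * ψ x ^ (-qex n - 1)
      + kap n * (t + lam x) ^ 2 * ψ x ^ (qex n - 1) = 0

/-- A weak maximum principle: a periodic `C¹` function which is strictly convex where it exceeds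
`K`, away from the multiples of `π`, is bounded above by `K`. -/
theorem le_of_periodic_of_second_deriv_pos {w v u : ℝ → ℝ} {K c : ℝ}
    (hc : c ≠ 0) (hper : Function.Periodic w c) (hw : ∀ x, HasDerivAt w (v x) x)
    (hv : Continuous v)
    (hu : ∀ x, (∀ k : ℤ, x ≠ (k : ℝ) * π) → HasDerivAt v (u x) x ∧ (K < w x → 0 < u x)) (x : ℝ) :
    w x ≤ K := by
  have hwc : Continuous w := continuous_iff_continuousAt.2 fun x => (hw x).continuousAt
  obtain ⟨x₀, hx₀⟩ : ∃ x₀, ∀ y, w y ≤ w x₀ := by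
    have hcpt := hper.compact_of_continuous hc hwc
    obtain ⟨_, ⟨x₀, rfl⟩, h⟩ := hcpt.exists_isGreatest (Set.range_nonempty w)
    exact ⟨x₀, fun y => h ⟨y, rfl⟩⟩
  refine (hx₀ x).trans (not_lt.1 fun hK => ?_)
  have hv0 : v x₀ = 0 :=
    IsLocalMax.hasDerivAt_eq_zero (Eventually.of_forall hx₀) (hw x₀)
  obtain ⟨δ, hδ, hball⟩ := Metric.mem_nhds_iff.1 (hwc.continuousAt.eventually (lt_mem_nhds hK))
  set k : ℤ := ⌊x₀ / π⌋
  have hk1 : (k : ℝ) * π ≤ x₀ := (le_div_iff₀ pi_pos).1 (Int.floor_le _)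
  have hk2 : x₀ < ((k : ℝ) + 1) * π := (div_lt_iff₀ pi_pos).1 (Int.lt_floor_add_one _)
  obtain ⟨y, hy0, hy⟩ := exists_between (lt_min (lt_add_of_pos_right x₀ hδ) hk2)
  obtain ⟨hyδ, hyk⟩ := lt_min_iff.1 hy
  have hin : ∀ z ∈ Set.Ioo x₀ y, HasDerivAt v (u z) z ∧ 0 < u z := by
    rintro z ⟨hz1, hz2⟩
    have h := hu z fun j hj => by
      have h1 : (k : ℝ) * π < j * π := by linarith
      have h2 : (j : ℝ) * π < ((k : ℝ) + 1) * π := by linarith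
      have h1' := lt_of_mul_lt_mul_right h1 pi_pos.le
      have h2' := lt_of_mul_lt_mul_right h2 pi_pos.le
      norm_cast at h1' h2'
      omega
    refine ⟨h.1, h.2 (hball ?_)⟩
    rw [Metric.mem_ball, Real.dist_eq, abs_of_pos (by linarith)]
    linarith
  have hvmono : StrictMonoOn v (Set.Icc x₀ y) := by
    refine strictMonoOn_of_deriv_pos (convex_Icc _ _) hv.continuousOn fun z hz => ?_
    rw [interior_Icc] at hz
    rw [(hin z hz).1.deriv]
    exact (hin z hz).2
  have hwmono : StrictMonoOn w (Set.Icc x₀ y) := by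
    refine strictMonoOn_of_deriv_pos (convex_Icc _ _) hwc.continuousOn fun z hz => ?_
    rw [interior_Icc] at hz
    rw [(hw z).deriv, ← hv0]
    exact hvmono (Set.left_mem_Icc.2 hy0.le) ⟨hz.1.le, hz.2.le⟩ hz.1
  exact (hwmono (Set.left_mem_Icc.2 hy0.le) (Set.right_mem_Icc.2 hy0.le) hy0).not_ge (hx₀ y)

theorem lam_eq_neg_one_or_one (x : ℝ) : lam x = -1 ∨ lam x = 1 := by
  unfold lam
  split_ifs <;> simp

theorem two_lt_qex {n : ℕ} (hn : 3 ≤ n) : 2 < qex n := by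
  have h : (3 : ℝ) ≤ n := by exact_mod_cast hn
  rw [qex, lt_div_iff₀ (by linarith)]
  linarith

theorem kap_pos {n : ℕ} (hn : 3 ≤ n) : 0 < kap n := by
  have h : (3 : ℝ) ≤ n := by exact_mod_cast hn
  exact div_pos (by linarith) (by linarith)

/-- The coefficient of `ψ ^ (-q - 1)` in the model Lichnerowicz equation. -/
noncomputable def ttCoeff (n : ℕ) (γ η μ d x : ℝ) : ℝ :=
  2 * η ^ 2 * d ^ (-(2 * qex n)) + kap n * (μ * d ^ (-qex n) + γ + lam x) ^ 2

theorem ttCoeff_nonneg {n : ℕ} (hn : 3 ≤ n) {γ η μ d : ℝ} (hd : 0 < d) (x : ℝ) :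
    0 ≤ ttCoeff n γ η μ d x := by
  have := kap_pos hn
  unfold ttCoeff
  positivity

namespace IsModelSolution

variable {n : ℕ} {t γ η μ d : ℝ} {ψ : ℝ → ℝ}

theorem hasDerivAt (h : IsModelSolution n t γ η μ d ψ) (x : ℝ) : HasDerivAt ψ (deriv ψ x) x :=
  (h.2.2.1.differentiable one_ne_zero x).hasDerivAt

theorem continuous_deriv (h : IsModelSolution n t γ η μ d ψ) : Continuous (deriv ψ) :=
  h.2.2.1.continuous_deriv le_rfl

theorem deriv_deriv_eq (h : IsModelSolution n t γ η μ d ψ) {x : ℝ}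
    (hx : ∀ k : ℤ, x ≠ (k : ℝ) * π) :
    2 * kap n * qex n * d ^ (-(qex n - 2)) * deriv (deriv ψ) x =
      kap n * (t + lam x) ^ 2 * ψ x ^ (qex n - 1)
        - ttCoeff n γ η μ d x * ψ x ^ (-qex n - 1) := by
  have := (h.2.2.2 x hx).2
  unfold ttCoeff
  linarith

/-- A pointwise bound between the two coefficients of the equation gives a lower bound. -/
theorem le_of_mul_le_ttCoeff (hn : 3 ≤ n) (hd : 0 < d) (h : IsModelSolution n t γ η μ d ψ)
    {m : ℝ} (hA : ∀ x, kap n * (t + lam x) ^ 2 * m ^ (2 * qex n) ≤ ttCoeff n γ η μ d x)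
    (hB : ∀ x, 0 < (t + lam x) ^ 2) (x : ℝ) :
    m ≤ ψ x := by
  have hq := two_lt_qex hn
  have hk := kap_pos hn
  have he : 0 < 2 * kap n * qex n * d ^ (-(qex n - 2)) := by positivity
  refine neg_le_neg_iff.1 (le_of_periodic_of_second_deriv_pos (w := fun x => -ψ x)
    (v := fun x => -deriv ψ x) (u := fun x => -deriv (deriv ψ) x) two_pi_pos.ne' ?_
    (fun x => (h.hasDerivAt x).neg) h.continuous_deriv.neg (fun x hx => ⟨?_, fun hlt => ?_⟩) x)
  · intro x
    simp only [h.1 x]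
  · exact (h.2.2.2 x hx).1.hasDerivAt.neg
  · have hlt : ψ x < m := neg_lt_neg_iff.1 hlt
    have hpos := h.2.1 x
    have heq := h.deriv_deriv_eq hx
    have hpow : ψ x ^ (qex n - 1) = ψ x ^ (2 * qex n) * ψ x ^ (-qex n - 1) := by
      rw [← rpow_add hpos]
      ring_nf
    have hcmp : kap n * (t + lam x) ^ 2 * ψ x ^ (2 * qex n) < ttCoeff n γ η μ d x :=
      (mul_lt_mul_of_pos_left (rpow_lt_rpow hpos.le hlt (by linarith))
        (mul_pos hk (hB x))).trans_le (hA x)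
    have hlt' := mul_lt_mul_of_pos_right hcmp (rpow_pos_of_pos hpos (-qex n - 1))
    rw [hpow] at heq
    refine neg_pos.2 (neg_of_mul_neg_right (b := deriv (deriv ψ) x) ?_ he.le)
    rw [heq]
    linarith

/-- Comparison of two solutions bounded below by `m` which differ only in `η` and `μ`. -/
theorem sub_le (hn : 3 ≤ n) (hd : 0 < d) {η' μ' : ℝ} {φ : ℝ → ℝ}
    (h : IsModelSolution n t γ η μ d ψ) (h' : IsModelSolution n t γ η' μ' d φ)
    {m b E : ℝ} (hm : 0 < m) (hb : 0 < b) (hE : 0 ≤ E) (hψ : ∀ x, m ≤ ψ x) (hφ : ∀ x, m ≤ φ x)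
    (hB : ∀ x, b ≤ (t + lam x) ^ 2)
    (hA : ∀ x, ttCoeff n γ η μ d x - ttCoeff n γ η' μ' d x ≤ E) (x : ℝ) :
    ψ x - φ x ≤ E * m ^ (-qex n - 1) / (kap n * b * m ^ (qex n - 2)) := by
  have hq := two_lt_qex hn
  have hk := kap_pos hn
  have he : 0 < 2 * kap n * qex n * d ^ (-(qex n - 2)) := by positivity
  refine le_of_periodic_of_second_deriv_pos (w := fun x => ψ x - φ x)
    (v := fun x => deriv ψ x - deriv φ x) (u := fun x => deriv (deriv ψ) x - deriv (deriv φ) x)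
    two_pi_pos.ne' ?_ (fun x => (h.hasDerivAt x).sub (h'.hasDerivAt x))
    (h.continuous_deriv.sub h'.continuous_deriv) (fun x hx => ⟨?_, fun hlt => ?_⟩) x
  · intro x
    simp only [h.1 x, h'.1 x]
  · exact (h.2.2.2 x hx).1.hasDerivAt.sub (h'.2.2.2 x hx).1.hasDerivAt
  · have hψpos := h.2.1 x
    have hφpos := h'.2.1 x
    have hwpos : 0 < ψ x - φ x := lt_of_le_of_lt (by positivity) hlt
    have hle : φ x ≤ ψ x := by linarith
    rw [div_lt_iff₀ (by positivity)] at hlt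
    have hsplit : ∀ {s : ℝ}, 0 < s → s ^ (qex n - 1) = s ^ (qex n - 2) * s := fun {s} hs => by
      rw [← rpow_add_one hs.ne']
      ring_nf
    have hgrow : m ^ (qex n - 2) * (ψ x - φ x) ≤ ψ x ^ (qex n - 1) - φ x ^ (qex n - 1) := by
      rw [hsplit hψpos, hsplit hφpos]
      have h1 := mul_le_mul_of_nonneg_right
        (rpow_le_rpow hm.le (hφ x) (by linarith : 0 ≤ qex n - 2)) hwpos.le
      have h2 := mul_le_mul_of_nonneg_right
        (rpow_le_rpow hφpos.le hle (by linarith : 0 ≤ qex n - 2)) hψpos.le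
      linarith
    have hB' : kap n * b * (m ^ (qex n - 2) * (ψ x - φ x)) ≤
        kap n * (t + lam x) ^ 2 * (ψ x ^ (qex n - 1) - φ x ^ (qex n - 1)) :=
      mul_le_mul (mul_le_mul_of_nonneg_left (hB x) hk.le) hgrow (by positivity) (by positivity)
    have h3 := mul_le_mul_of_nonneg_left
      (rpow_le_rpow_of_nonpos hφpos hle (by linarith : -qex n - 1 ≤ 0))
      (ttCoeff_nonneg hn (γ := γ) (η := η') (μ := μ') hd x)
    have h4 := mul_le_mul_of_nonneg_right (hA x) (rpow_nonneg hψpos.le (-qex n - 1))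
    have h5 := mul_le_mul_of_nonneg_left
      (rpow_le_rpow_of_nonpos hm (hψ x) (by linarith : -qex n - 1 ≤ 0)) hE
    refine pos_of_mul_pos_right (b := deriv (deriv ψ) x - deriv (deriv φ) x) ?_ he.le
    rw [mul_sub, h.deriv_deriv_eq hx, h'.deriv_deriv_eq hx]
    linarith

end IsModelSolution

/-- The coefficient `ttCoeff` is a perturbation of size `d ^ (-q)` of its value at `η = μ = 0`. -/
theorem abs_ttCoeff_sub_le {n : ℕ} (hn : 3 ≤ n) {γ η μ d : ℝ} (hγ : |γ| ≤ 1) (hd : 1 ≤ d) (x : ℝ) :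
    |ttCoeff n γ η μ d x - ttCoeff n γ 0 0 d x| ≤
      (2 * η ^ 2 + kap n * (μ ^ 2 + 4 * |μ|)) * d ^ (-qex n) := by
  have hq := two_lt_qex hn
  have hk := kap_pos hn
  have hp0 : 0 < d ^ (-qex n) := rpow_pos_of_pos (by linarith) _
  have hp1 : d ^ (-qex n) ≤ 1 := rpow_le_one_of_one_le_of_nonpos hd (by linarith)
  have h2 : d ^ (-(2 * qex n)) = d ^ (-qex n) * d ^ (-qex n) := by
    rw [← rpow_add (by linarith)]
    ring_nf
  unfold ttCoeff
  rw [h2]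
  generalize d ^ (-qex n) = p at *
  have hg : |γ + lam x| ≤ 2 := by
    rw [abs_le] at hγ ⊢
    rcases lam_eq_neg_one_or_one x with h | h <;> rw [h] <;> constructor <;> linarith
  have hexp : 2 * η ^ 2 * (p * p) + kap n * (μ * p + γ + lam x) ^ 2
      - (2 * 0 ^ 2 * (p * p) + kap n * (0 * p + γ + lam x) ^ 2) =
      ((2 * η ^ 2 + kap n * μ ^ 2) * p + kap n * (2 * (μ * (γ + lam x)))) * p := by ring
  rw [hexp, abs_mul, abs_of_pos hp0]
  refine mul_le_mul_of_nonneg_right ((abs_add_le _ _).trans ?_) hp0.le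
  have hc : 0 ≤ 2 * η ^ 2 + kap n * μ ^ 2 := by positivity
  rw [abs_mul, abs_of_nonneg hc, abs_of_pos hp0, abs_mul, abs_of_pos hk, abs_mul, abs_mul,
    abs_of_pos (two_pos : (0 : ℝ) < 2)]
  have h3 := mul_le_mul_of_nonneg_left hp1 hc
  have h4 := mul_le_mul_of_nonneg_left (mul_le_mul_of_nonneg_left hg (abs_nonneg μ)) hk.le
  linarith

/-- Closeness to the vanishing-TT solution for large d (Proposition 3.25). -/
theorem close_to_vanishing_TT (n : ℕ) (hn : 3 ≤ n) (t γ η μ : ℝ)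
    (hγ : -1 < γ ∧ γ < 1) (ht : |t| ≠ 1) :
    ∃ c : ℝ, 0 < c ∧ ∃ D : ℝ, 0 < D ∧
      ∀ d : ℝ, D ≤ d →
        ∀ ψ ψhat : ℝ → ℝ,
          IsModelSolution n t γ η μ d ψ → IsModelSolution n t γ 0 0 d ψhat →
          ∀ x : ℝ, |ψ x - ψhat x| ≤ c * d ^ (-qex n) := by
  have hq := two_lt_qex hn
  have hk := kap_pos hn
  have hγ1 : |γ| < 1 := abs_lt.2 hγ
  set δ : ℝ := (1 - |γ|) / 2 with hδ
  have hδpos : 0 < δ := by rw [hδ]; linarith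
  set r : ℝ := δ ^ 2 / (|t| + 1) ^ 2 with hr
  have hrpos : 0 < r := by positivity
  set m : ℝ := r ^ (2 * qex n)⁻¹
  have hmpos : 0 < m := rpow_pos_of_pos hrpos _
  have hmr : m ^ (2 * qex n) = r := rpow_inv_rpow hrpos.le (by positivity)
  set b : ℝ := (1 - |t|) ^ 2 with hb
  have hbpos : 0 < b := sq_pos_of_ne_zero (sub_ne_zero.2 ht.symm)
  have hB : ∀ x, b ≤ (t + lam x) ^ 2 := fun x => by
    have := neg_abs_le t
    have := le_abs_self t
    rcases lam_eq_neg_one_or_one x with h | h <;> rw [h, hb] <;>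
      nlinarith [sq_abs t]
  have hB' : ∀ x, (t + lam x) ^ 2 ≤ (|t| + 1) ^ 2 := fun x => by
    have := neg_abs_le t
    have := le_abs_self t
    rcases lam_eq_neg_one_or_one x with h | h <;> rw [h] <;> nlinarith [sq_abs t]
  set S : ℝ := 2 * η ^ 2 + kap n * (μ ^ 2 + 4 * |μ|)
  have hS0 : 0 ≤ S := by positivity
  obtain ⟨D, hD⟩ : ∃ D : ℝ, ∀ d ≥ D, |μ| * d ^ (-qex n) < δ := by
    have := (tendsto_rpow_neg_atTop (by linarith : 0 < qex n)).const_mul |μ|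
    rw [mul_zero] at this
    exact eventually_atTop.1 (this.eventually (gt_mem_nhds hδpos))
  have hlow : ∀ η' μ' d : ℝ, 0 < d → |μ'| * d ^ (-qex n) < δ → ∀ ψ : ℝ → ℝ,
      IsModelSolution n t γ η' μ' d ψ → ∀ x, m ≤ ψ x := by
    intro η' μ' d hd hsmall ψ hψ
    refine hψ.le_of_mul_le_ttCoeff hn hd (fun x => ?_) fun x => hbpos.trans_le (hB x)
    have h1 : (t + lam x) ^ 2 * r ≤ δ ^ 2 := by
      calc (t + lam x) ^ 2 * r ≤ (|t| + 1) ^ 2 * r :=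
            mul_le_mul_of_nonneg_right (hB' x) hrpos.le
        _ = δ ^ 2 := by rw [hr]; field_simp
    have h2 : δ ^ 2 ≤ (μ' * d ^ (-qex n) + γ + lam x) ^ 2 := by
      rw [← abs_of_pos (rpow_pos_of_pos hd (-qex n)), ← abs_mul] at hsmall
      have h3 := abs_lt.1 hsmall
      have h4 := neg_abs_le γ
      have h5 := le_abs_self γ
      refine sq_le_sq.2 ?_
      rw [abs_of_pos hδpos, le_abs]
      rcases lam_eq_neg_one_or_one x with h | h <;> rw [h]
      · right; linarith [h3.2]
      · left; linarith [h3.1]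
    have h3 : 0 ≤ 2 * η' ^ 2 * d ^ (-(2 * qex n)) := by positivity
    have h4 := mul_le_mul_of_nonneg_left (h1.trans h2) hk.le
    rw [hmr, ttCoeff]
    linarith
  refine ⟨(S + 1) * m ^ (-qex n - 1) / (kap n * b * m ^ (qex n - 2)), by positivity, max D 1,
    by positivity, fun d hd ψ φ hψ hφ x => ?_⟩
  obtain ⟨hdD, hd1⟩ := max_le_iff.1 hd
  have hd0 : 0 < d := by linarith
  have hp0 : 0 < d ^ (-qex n) := rpow_pos_of_pos hd0 _
  have hψm := hlow η μ d hd0 (hD d hdD) ψ hψ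
  have hφm := hlow 0 0 d hd0 (by simpa using hδpos) φ hφ
  have hE : ∀ x, |ttCoeff n γ η μ d x - ttCoeff n γ 0 0 d x| ≤ (S + 1) * d ^ (-qex n) := fun x =>
    (abs_ttCoeff_sub_le hn hγ1.le hd1 x).trans (mul_le_mul_of_nonneg_right (lt_add_one S).le hp0.le)
  have hE0 : 0 ≤ (S + 1) * d ^ (-qex n) := by positivity
  have hfin : (S + 1) * m ^ (-qex n - 1) / (kap n * b * m ^ (qex n - 2)) * d ^ (-qex n) =
      (S + 1) * d ^ (-qex n) * m ^ (-qex n - 1) / (kap n * b * m ^ (qex n - 2)) := by ring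
  rw [hfin]
  refine abs_sub_le_iff.2 ⟨?_, ?_⟩
  · exact hψ.sub_le hn hd0 hφ hmpos hbpos hE0 hψm hφm hB (fun x => (abs_sub_le_iff.1 (hE x)).1) x
  · exact hφ.sub_le hn hd0 hψ hmpos hbpos hE0 hφm hψm hB (fun x => (abs_sub_le_iff.1 (hE x)).2) x
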